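/- Every one-dimensional subalgebra of L is a CAP-subalgebra of L if and only if L is supersolvable, i.e. every chief factor H/K of L satisfies dim H = dim K + 1. -/

import Mathlib

section CAP

variable {F : Type*} {L : Type*} [Field F] [LieRing L] [LieAlgebra F L]

/-- `H/K` is a chief factor of `L`: `H`, `K` are Lie ideals with `K < H` and no Lie ideal
lies strictly between `K` and `H`. -/
def IsChiefFactor (H K : LieIdeal F L) : Prop :=
  K < H ∧ ¬∃ J : LieIdeal F L, K < J ∧ J < H

/-- The subalgebra `U` covers the factor `H/K` if `U + H = U + K`. -/
def Covers (U : LieSubalgebra F L) (H K : LieIdeal F L) : Prop :=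
  U.toSubmodule ⊔ H.toSubmodule = U.toSubmodule ⊔ K.toSubmodule

/-- The subalgebra `U` avoids the factor `H/K` if `U ∩ H = U ∩ K`. -/
def Avoids (U : LieSubalgebra F L) (H K : LieIdeal F L) : Prop :=
  U.toSubmodule ⊓ H.toSubmodule = U.toSubmodule ⊓ K.toSubmodule

/-- `U` is a CAP-subalgebra of `L` if it covers or avoids every chief factor of `L`. -/
def IsCAPSubalgebra (U : LieSubalgebra F L) : Prop :=
  ∀ H K : LieIdeal F L, IsChiefFactor H K → Covers U H K ∨ Avoids U H K

end CAP

/-- The line spanned by an element, as a Lie subalgebra. -/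
def LieSubalgebra.line (F : Type*) {L : Type*} [Field F] [LieRing L] [LieAlgebra F L] (x : L) :
    LieSubalgebra F L :=
  { Submodule.span F {x} with
    lie_mem' := by
      intro a b ha hb
      obtain ⟨r, rfl⟩ := Submodule.mem_span_singleton.mp ha
      obtain ⟨s, rfl⟩ := Submodule.mem_span_singleton.mp hb
      simp }

section ChiefFactor

variable {F : Type*} {L : Type*} [Field F] [LieRing L] [LieAlgebra F L]

theorem IsChiefFactor.toSubmodule_lt {H K : LieIdeal F L} (h : IsChiefFactor H K) :
    K.toSubmodule < H.toSubmodule :=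
  h.1

variable [FiniteDimensional F L]

theorem Covers.finrank_eq_add_one {U : LieSubalgebra F L} {H K : LieIdeal F L}
    (hU : Module.finrank F U = 1) (hKH : IsChiefFactor H K) (h : Covers U H K) :
    Module.finrank F H = Module.finrank F K + 1 := by
  have hle : H.toSubmodule ≤ U.toSubmodule ⊔ K.toSubmodule := le_sup_right.trans_eq h
  have h₁ : Module.finrank F K < Module.finrank F H :=
    Submodule.finrank_lt_finrank_of_lt hKH.toSubmodule_lt
  have h₂ : Module.finrank F H ≤ Module.finrank F U + Module.finrank F K :=
    (Submodule.finrank_mono hle).trans (Submodule.finrank_add_le_finrank_add_finrank _ _)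
  omega

theorem IsChiefFactor.covers_or_avoids {H K : LieIdeal F L} (hKH : IsChiefFactor H K)
    (h : Module.finrank F H = Module.finrank F K + 1) (U : LieSubalgebra F L) :
    Covers U H K ∨ Avoids U H K := by
  have hle := hKH.toSubmodule_lt.le
  by_cases hU : U.toSubmodule ⊓ H.toSubmodule ≤ K.toSubmodule
  · exact Or.inr (le_antisymm (le_inf inf_le_left hU) (inf_le_inf_left _ hle))
  · left
    have hlt : K.toSubmodule < K.toSubmodule ⊔ U.toSubmodule ⊓ H.toSubmodule :=
      left_lt_sup.mpr hU
    have h₁ : Module.finrank F K < _ := Submodule.finrank_lt_finrank_of_lt hlt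
    have heq : K.toSubmodule ⊔ U.toSubmodule ⊓ H.toSubmodule = H.toSubmodule :=
      Submodule.eq_of_le_of_finrank_le (sup_le hle inf_le_right) (h.trans_le h₁)
    refine le_antisymm (sup_le le_sup_left ?_) (sup_le_sup_left hle _)
    rw [← heq]
    exact sup_le le_sup_right (inf_le_left.trans le_sup_left)

end ChiefFactor

/-- Every one-dimensional subalgebra of `L` is a CAP-subalgebra iff `L` is supersolvable,
i.e. every chief factor of `L` is one-dimensional. -/
theorem stmt10 {F : Type*} {L : Type*} [Field F] [LieRing L] [LieAlgebra F L]
    [FiniteDimensional F L] :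
    (∀ U : LieSubalgebra F L, Module.finrank F U = 1 → IsCAPSubalgebra U) ↔
      ∀ H K : LieIdeal F L, IsChiefFactor H K →
        Module.finrank F H = Module.finrank F K + 1 := by
  refine ⟨fun hL H K hKH => ?_, fun hL U _ H K hKH => hKH.covers_or_avoids (hL H K hKH) U⟩
  obtain ⟨x, hxH, hxK⟩ := SetLike.exists_of_lt hKH.1
  have hx : x ≠ 0 := fun h => hxK (h ▸ K.zero_mem)
  have hU : Module.finrank F (LieSubalgebra.line F x) = 1 := finrank_span_singleton hx
  refine ((hL _ hU H K hKH).resolve_right fun hav => ?_).finrank_eq_add_one hU hKH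
  have hmem : x ∈ (LieSubalgebra.line F x).toSubmodule ⊓ H.toSubmodule :=
    ⟨Submodule.mem_span_singleton_self x, hxH⟩
  rw [hav] at hmem
  exact hxK hmem.2
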